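/- Let S = ((n₁,m₁),…,(n_k,m_k)) be a shape with m₁ = 2 and n₁ ≥ 2, let N = Σᵢ nᵢmᵢ, and let d be an integer with d ≥ N − n₁. Then C(N,2) + 3 + Σ_{i=2}^k nᵢ·C(mᵢ+1,2) ≤ N·d + 1, and equality holds if and only if k = 1, n₁ = 2 (so N = 4) and d = 2. -/

import Mathlib

/-- Twice a binomial coefficient `C(a,2)`, over the integers. -/
theorem two_mul_cast_choose_two (a : ℕ) : 2 * (a.choose 2 : ℤ) = a * (a - 1) := by
  have h := Nat.cast_choose_two ℚ a
  have hq : (2 * (a.choose 2 : ℤ) : ℚ) = a * (a - 1) := by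
    push_cast
    rw [h]
    ring
  exact_mod_cast hq

/-- If `M = ∑ nᵢmᵢ`, then `2 ∑ nᵢ C(mᵢ+1,2) ≤ M(M+1)`. -/
theorem two_mul_sum_mul_choose_two_le {ι : Type*} (s : Finset ι) (n m : ι → ℕ)
    (hn : ∀ i ∈ s, 0 < n i) :
    2 * ∑ i ∈ s, (n i : ℤ) * ((m i + 1).choose 2 : ℤ)
      ≤ (∑ i ∈ s, (n i : ℤ) * m i) * (∑ i ∈ s, (n i : ℤ) * m i + 1) := by
  rw [Finset.mul_sum, Finset.sum_mul]
  refine Finset.sum_le_sum fun i hi => ?_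
  have hle : (n i : ℤ) * m i ≤ ∑ j ∈ s, (n j : ℤ) * m j :=
    Finset.single_le_sum (f := fun j => (n j : ℤ) * m j) (fun j _ => by positivity) hi
  have hni : (1 : ℤ) ≤ n i := by exact_mod_cast hn i hi
  have hmi : (m i : ℤ) ≤ n i * m i := le_mul_of_one_le_left (by positivity) hni
  have hc := two_mul_cast_choose_two (m i + 1)
  push_cast at hc
  calc 2 * ((n i : ℤ) * ((m i + 1).choose 2 : ℤ))
      = n i * m i * (m i + 1) := by linear_combination (n i : ℤ) * hc
    _ ≤ _ := mul_le_mul_of_nonneg_left (by linarith) (by positivity)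

/-- Let `S = ((n₁,m₁),…,(n_k,m_k))` be a shape (all `nᵢ, mᵢ` positive,
`k ≥ 1`) with `m₁ = 2` and `n₁ ≥ 2`, let `N = Σᵢ nᵢmᵢ`, and let `d` be an integer with
`d ≥ N − n₁`.  Then `C(N,2) + 3 + Σ_{i=2}^k nᵢ·C(mᵢ+1,2) ≤ N·d + 1`, with equality
if and only if `k = 1`, `n₁ = 2` (so `N = 4`) and `d = 2`. -/
theorem shape_bound_m1_eq_two
    (k : ℕ) (hk : 0 < k) (n m : Fin k → ℕ)
    (hn : ∀ i, 0 < n i) (hm : ∀ i, 0 < m i)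
    (N : ℕ) (hN : N = ∑ i, n i * m i)
    (hm1 : m ⟨0, hk⟩ = 2) (hn1 : 2 ≤ n ⟨0, hk⟩)
    (d : ℤ) (hd : (N : ℤ) - (n ⟨0, hk⟩ : ℤ) ≤ d) :
    (N.choose 2 : ℤ) + 3
        + ∑ i ∈ Finset.univ.erase ⟨0, hk⟩, (n i : ℤ) * ((m i + 1).choose 2 : ℤ)
      ≤ (N : ℤ) * d + 1 ∧
    ((N.choose 2 : ℤ) + 3
        + ∑ i ∈ Finset.univ.erase ⟨0, hk⟩, (n i : ℤ) * ((m i + 1).choose 2 : ℤ)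
      = (N : ℤ) * d + 1 ↔ k = 1 ∧ n ⟨0, hk⟩ = 2 ∧ d = 2) := by
  have hT := two_mul_sum_mul_choose_two_le (Finset.univ.erase ⟨0, hk⟩) n m (fun i _ => hn i)
  have hNM : (N : ℤ) = 2 * n ⟨0, hk⟩
      + ∑ i ∈ Finset.univ.erase ⟨0, hk⟩, (n i : ℤ) * m i := by
    rw [hN, ← Finset.add_sum_erase Finset.univ _ (Finset.mem_univ ⟨0, hk⟩), hm1]
    push_cast
    ring
  have hM0 : 0 ≤ ∑ i ∈ Finset.univ.erase ⟨0, hk⟩, (n i : ℤ) * m i :=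
    Finset.sum_nonneg fun i _ => by positivity
  have hMk : ∑ i ∈ Finset.univ.erase ⟨0, hk⟩, (n i : ℤ) * m i = 0 → k = 1 := by
    intro h
    rw [Finset.sum_eq_zero_iff_of_nonneg (fun i _ => by positivity)] at h
    by_contra hk1
    have h1 : 1 < k := by omega
    have hpos : (0 : ℤ) < n ⟨1, h1⟩ * m ⟨1, h1⟩ := by
      exact_mod_cast Nat.mul_pos (hn ⟨1, h1⟩) (hm ⟨1, h1⟩)
    exact hpos.ne' (h ⟨1, h1⟩ (by simp))
  have hchoose := two_mul_cast_choose_two N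
  have ha : (2 : ℤ) ≤ n ⟨0, hk⟩ := by exact_mod_cast hn1
  have hk1 : k = 1 → (Finset.univ.erase ⟨0, hk⟩ : Finset (Fin k)) = ∅ := by
    rintro rfl
    rfl
  have key : k = 1 ∧ n ⟨0, hk⟩ = 2 ∧ d = 2 →
      (N.choose 2 : ℤ) + 3
        + ∑ i ∈ Finset.univ.erase ⟨0, hk⟩, (n i : ℤ) * ((m i + 1).choose 2 : ℤ)
      = (N : ℤ) * d + 1 := by
    rintro ⟨h, hn2, rfl⟩
    rw [hk1 h, Finset.sum_empty, hn2] at hNM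
    rw [hk1 h, Finset.sum_empty]
    rw [hNM] at hchoose ⊢
    norm_num at hchoose ⊢
    linarith
  generalize ∑ i ∈ Finset.univ.erase ⟨0, hk⟩, (n i : ℤ) * ((m i + 1).choose 2 : ℤ) = T at *
  generalize ∑ i ∈ Finset.univ.erase ⟨0, hk⟩, (n i : ℤ) * m i = M at *
  -- The slack in the inequality is at least `N (d - (N - n₁)) + n₁ (M + 1) - 2`.
  have hslack : (N : ℤ) * (d - (N - n ⟨0, hk⟩)) + (n ⟨0, hk⟩ - 2) + n ⟨0, hk⟩ * M
      ≤ N * d + 1 - ((N.choose 2 : ℤ) + 3 + T) := by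
    rw [hNM] at hchoose ⊢
    linarith
  have hNpos : (0 : ℤ) < N := by linarith
  have h₁ : 0 ≤ (N : ℤ) * (d - (N - n ⟨0, hk⟩)) := mul_nonneg hNpos.le (by linarith)
  have h₂ : 0 ≤ (n ⟨0, hk⟩ : ℤ) * M := by positivity
  refine ⟨by linarith, fun h => ?_, key⟩
  have hn2 : (n ⟨0, hk⟩ : ℤ) = 2 := by linarith
  have hM : M = 0 := by
    have : (n ⟨0, hk⟩ : ℤ) * M = 0 := by linarith
    rw [hn2] at this
    linarith
  have hdN : d - (N - n ⟨0, hk⟩) = 0 := by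
    have : (N : ℤ) * (d - (N - n ⟨0, hk⟩)) = 0 := by linarith
    exact (mul_eq_zero.mp this).resolve_left hNpos.ne'
  exact ⟨hMk hM, by exact_mod_cast hn2, by linarith⟩
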